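/- Let (Ω, p) be a finite probability space, Ω' a finite set, and f : Ω → Ω' a function, and let X = oi(f) := {A ⊆ Ω : |f(A)| ≤ 1} be the induced ordinary information. Then: H(X) equals the Shannon entropy Σ_{y∈Ω'} p(f⁻¹(y)) log₂(1/p(f⁻¹(y))) of the pushforward distribution (with 0·log₂(1/0) = 0); H∞(X) = −log₂ max_{y∈Ω'} p(f⁻¹(y)); and H₀(X) = Hε(X) = log₂ |{y ∈ Ω' : p(f⁻¹(y)) > 0}|. -/

import Mathlib

open Finset
open scoped Classical ENNReal

noncomputable section

variable {Ω : Type*}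

/-- `X` is a confusion hypergraph (hyperconfusion) over `Ω`: a nonempty,
downward-closed family of subsets of `Ω`. -/
def IsHyp (X : Finset (Finset Ω)) : Prop :=
  X.Nonempty ∧ ∀ A ∈ X, ∀ B ⊆ A, B ∈ X

/-- `p` is a probability mass function on the finite type `Ω`. -/
def IsPMF [Fintype Ω] (p : Ω → ℝ) : Prop :=
  (∀ ω, 0 ≤ p ω) ∧ ∑ ω : Ω, p ω = 1

/-- The probability of a set `A` under the pmf `p`. -/
def pset (p : Ω → ℝ) (A : Finset Ω) : ℝ := ∑ ω ∈ A, p ω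

/-- A valid conditional pmf `k` from `Ω` to (pmfs on) `X`: nonnegative, sums to one,
supported on `X`, and `k A z > 0` with `p z > 0` implies `z ∈ A`. -/
def ValidK [Fintype Ω] (p : Ω → ℝ) (X : Finset (Finset Ω)) (k : Ω → Finset Ω → ℝ) : Prop :=
  (∀ z A, 0 ≤ k z A) ∧ (∀ z, ∑ A : Finset Ω, k z A = 1) ∧
    (∀ z A, 0 < k z A → A ∈ X) ∧ ∀ z A, 0 < p z → 0 < k z A → z ∈ A

/-- The mutual information `I(Z;A)` where `Z ∼ p` and `A | Z ∼ k`. -/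
def MI [Fintype Ω] (p : Ω → ℝ) (k : Ω → Finset Ω → ℝ) : ℝ :=
  ∑ z : Ω, ∑ A : Finset Ω,
    p z * k z A * Real.logb 2 (k z A / ∑ z' : Ω, p z' * k z' A)

/-- The entropy `H(X)` of a hyperconfusion `X` over `(Ω, p)`, valued in `[0,∞]`
(`∞` when no valid conditional pmf exists). -/
def Hent [Fintype Ω] (p : Ω → ℝ) (X : Finset (Finset Ω)) : ℝ≥0∞ :=
  ⨅ (k : Ω → Finset Ω → ℝ) (_ : ValidK p X k), ENNReal.ofReal (MI p k)

/-- `−log₂ x = log₂ (1/x)`, valued in `[0,∞]` (equals `∞` when `x ≤ 0`). -/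
def negLog2 (x : ℝ) : ℝ≥0∞ :=
  if x ≤ 0 then ⊤ else ENNReal.ofReal (Real.logb 2 x⁻¹)

/-- The min-entropy `H∞(X) = −log₂ max_{A ∈ X} p(A)`. -/
def Hmin [Fintype Ω] (p : Ω → ℝ) (X : Finset (Finset Ω)) : ℝ≥0∞ :=
  ⨅ A ∈ X, negLog2 (pset p A)

/-- The integral max-entropy `H₀(X)`: `log₂` of the minimum cardinality of a subfamily
of `X` covering `supp(p)` (`∞` if there is none). -/
def H0ent [Fintype Ω] (p : Ω → ℝ) (X : Finset (Finset Ω)) : ℝ≥0∞ :=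
  ⨅ (S : Finset (Finset Ω))
    (_ : S ⊆ X ∧ ∀ ω : Ω, 0 < p ω → ∃ A ∈ S, ω ∈ A),
    ENNReal.ofReal (Real.logb 2 (S.card : ℝ))

/-- The fractional max-entropy `Hε(X)`: `log₂` of the minimum total weight of a
fractional covering of `supp(p)` by members of `X` (`∞` if there is none). -/
def Heps [Fintype Ω] (p : Ω → ℝ) (X : Finset (Finset Ω)) : ℝ≥0∞ :=
  ⨅ (μ : Finset Ω → ℝ)
    (_ : (∀ A, 0 ≤ μ A) ∧ (∀ A, μ A ≠ 0 → A ∈ X) ∧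
      ∀ ω : Ω, 0 < p ω → 1 ≤ ∑ A ∈ X, if ω ∈ A then μ A else 0),
    ENNReal.ofReal (Real.logb 2 (∑ A ∈ X, μ A))

/-- The support of the pmf `p`. -/
def suppP [Fintype Ω] (p : Ω → ℝ) : Finset Ω := univ.filter fun ω => 0 < p ω

/-- The support of a hyperconfusion: the points whose singleton is confusable. -/
def suppH [Fintype Ω] (X : Finset (Finset Ω)) : Finset Ω :=
  univ.filter fun ω => ({ω} : Finset Ω) ∈ X

/-- `X` is an ordinary information: the union of the powersets of a nonempty collection
of pairwise disjoint subsets of `Ω`. -/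
def IsOI (X : Finset (Finset Ω)) : Prop :=
  ∃ S : Finset (Finset Ω), S.Nonempty ∧
    (∀ A ∈ S, ∀ B ∈ S, A ≠ B → Disjoint A B) ∧
    ∀ C : Finset Ω, C ∈ X ↔ ∃ A ∈ S, C ⊆ A

/-- The Heyting implication `X → Y := {A ⊆ Ω : X ∩ 2^A ⊆ Y}` of hyperconfusions. -/
def himpHyp [Fintype Ω] (X Y : Finset (Finset Ω)) : Finset (Finset Ω) :=
  univ.filter fun A => ∀ B ∈ X, B ⊆ A → B ∈ Y

/-- `log₂` on `[0,∞]`. -/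
def elog2 (x : ℝ≥0∞) : ℝ≥0∞ :=
  if x = ⊤ then ⊤ else ENNReal.ofReal (Real.logb 2 x.toReal)

/-- The maximal members of a hyperconfusion (under inclusion). -/
def maxsHyp (X : Finset (Finset Ω)) : Finset (Finset Ω) :=
  X.filter fun A => ∀ B ∈ X, A ⊆ B → B = A

/-- The indicator vector of `A ⊆ Ω`, as an element of `ℝ^Ω`. -/
def indVec (A : Finset Ω) : Ω → ℝ := fun ω => if ω ∈ A then 1 else 0

/-- The ordinary information `oi(f) = {A : |f(A)| ≤ 1}` induced by a function `f`. -/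
def oiF {Ω' : Type*} [Fintype Ω] (f : Ω → Ω') : Finset (Finset Ω) :=
  univ.filter fun A : Finset Ω => (A.image f).card ≤ 1

/-- Independence of two hyperconfusions: all unions of maximal confusable sets are
independent events. -/
def IndepHyp [Fintype Ω] (p : Ω → ℝ) (X Y : Finset (Finset Ω)) : Prop :=
  ∀ S ⊆ maxsHyp X, ∀ T ⊆ maxsHyp Y,
    pset p ((S.biUnion id) ∩ (T.biUnion id)) =
      pset p (S.biUnion id) * pset p (T.biUnion id)

/-- The embedding `Xᵢ` of a hyperconfusion `X` over `Ω` into the product space `Ωⁿ`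
along coordinate `i`. -/
def embedHyp [Fintype Ω] (X : Finset (Finset Ω)) (n : ℕ) (i : Fin n) :
    Finset (Finset (Fin n → Ω)) :=
  univ.filter fun C => ∃ A ∈ X, ∀ ω ∈ C, ω i ∈ A

/-- The i.i.d. product pmf `p^⊗ⁿ` on `Ωⁿ`. -/
def pPow [Fintype Ω] (p : Ω → ℝ) (n : ℕ) : (Fin n → Ω) → ℝ :=
  fun ω => ∏ i, p (ω i)

/-- The conditional pmf `p(·|E)` (supported on `E`). -/
def condP [Fintype Ω] (p : Ω → ℝ) (E : Finset Ω) : Ω → ℝ :=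
  fun ω => if ω ∈ E then p ω / pset p E else 0

/-- The conditional entropy `H(X|E)` of the hyperconfusion `X ∩ 2^E` over the
conditional probability space `(E, p(·|E))`. -/
def HcondEvent [Fintype Ω] (p : Ω → ℝ) (X : Finset (Finset Ω)) (E : Finset Ω) : ℝ≥0∞ :=
  Hent (condP p E) (X ∩ E.powerset)

/-- The conditional entropy `H(X|Y) := p(E)·(H(X∩Y|E) − H(Y|E))` where `E = supp(Y)`,
taken to be `0` when `p(E) = 0`. -/
def Hcond [Fintype Ω] (p : Ω → ℝ) (X Y : Finset (Finset Ω)) : ℝ≥0∞ :=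
  if pset p (suppH Y) = 0 then 0
  else ENNReal.ofReal (pset p (suppH Y)) *
    (HcondEvent p (X ∩ Y) (suppH Y) - HcondEvent p Y (suppH Y))

/-- The singleton hyperconfusion `sing(Ω) = {∅} ∪ {{ω} : ω ∈ Ω}`. -/
def singHyp (α : Type*) [Fintype α] : Finset (Finset α) :=
  insert ∅ (univ.image fun ω : α => ({ω} : Finset α))

/-- A valid pmf `q` on `Ỹ` for the coarse entropy: supported on `Yt`, and dominating `p`
in the sense that `p(S) ≤ Σ_{B ∈ Yt, S∩B ≠ ∅} q(B)` for all `S`. -/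
def ValidQ [Fintype Ω] (p : Ω → ℝ) (Yt : Finset (Finset Ω)) (q : Finset Ω → ℝ) : Prop :=
  (∀ B, 0 ≤ q B) ∧ (∀ B, q B ≠ 0 → B ∈ Yt) ∧ (∑ B : Finset Ω, q B = 1) ∧
    ∀ S : Finset Ω, pset p S ≤ ∑ B ∈ Yt, if (S ∩ B).Nonempty then q B else 0

/-- A valid conditional pmf `m` from `Ỹ` to `X` for the coarse entropy:
`m A B > 0` with `q B > 0` implies `B ⊆ A`. -/
def ValidM [Fintype Ω] (X : Finset (Finset Ω)) (q : Finset Ω → ℝ)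
    (m : Finset Ω → Finset Ω → ℝ) : Prop :=
  (∀ B A, 0 ≤ m B A) ∧ (∀ B, ∑ A : Finset Ω, m B A = 1) ∧
    (∀ B A, 0 < m B A → A ∈ X) ∧ ∀ B A, 0 < q B → 0 < m B A → B ⊆ A

/-- The mutual information `I(B;A)` where `B ∼ q` and `A | B ∼ m`. -/
def MI2 [Fintype Ω] (q : Finset Ω → ℝ) (m : Finset Ω → Finset Ω → ℝ) : ℝ :=
  ∑ B : Finset Ω, ∑ A : Finset Ω,
    q B * m B A * Real.logb 2 (m B A / ∑ B' : Finset Ω, q B' * m B' A)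

/-- The coarse entropy `H(X ↘ Y)` of `X` with respect to `Y`. -/
def Hcoarse [Fintype Ω] (p : Ω → ℝ) (X Y : Finset (Finset Ω)) : ℝ≥0∞ :=
  if Y ∪ singHyp Ω ⊆ X then
    ⨆ (q : Finset Ω → ℝ) (_ : ValidQ p (Y ∪ singHyp Ω) q),
      ⨅ (m : Finset Ω → Finset Ω → ℝ) (_ : ValidM X q m), ENNReal.ofReal (MI2 q m)
  else ⊤

/-- The capacity `C(X) = max_p H(X)` of a hyperconfusion. -/
def capacity [Fintype Ω] (X : Finset (Finset Ω)) : ℝ≥0∞ :=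
  ⨆ (p : Ω → ℝ) (_ : IsPMF p), Hent p X

/-- The product hyperconfusion `X ⊗ Y` over `Ω × Γ`. -/
def prodHyp {Γ : Type*} [Fintype Ω] [Fintype Γ]
    (X : Finset (Finset Ω)) (Y : Finset (Finset Γ)) : Finset (Finset (Ω × Γ)) :=
  univ.filter fun C => ∃ A ∈ X, ∃ B ∈ Y, ∀ c ∈ C, c.1 ∈ A ∧ c.2 ∈ B

/-- The `n`-fold product hyperconfusion `X^⊗ⁿ` over `Ωⁿ`. -/
def powHyp [Fintype Ω] (X : Finset (Finset Ω)) (n : ℕ) : Finset (Finset (Fin n → Ω)) :=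
  univ.filter fun C => ∃ A : Fin n → Finset Ω, (∀ i, A i ∈ X) ∧ ∀ ω ∈ C, ∀ i, ω i ∈ A i

/-- `X ⊑ Y`: there is a surjective hyperconfusable set-valued function from `(Ω,X)`
to `(Γ,Y)`. -/
def ConfusesOnto {Γ : Type*} [Fintype Ω] [Fintype Γ]
    (X : Finset (Finset Ω)) (Y : Finset (Finset Γ)) : Prop :=
  ∃ β : Ω → Finset Γ, (∀ A ∈ X, A.biUnion β ∈ Y) ∧ univ.biUnion β = univ

/-- The confusion ratio `CR(X/Y) = sup{m/n : X^⊗ⁿ ⊑ Y^⊗ᵐ}`. -/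
def confRatio {Γ : Type*} [Fintype Ω] [Fintype Γ]
    (X : Finset (Finset Ω)) (Y : Finset (Finset Γ)) : ℝ≥0∞ :=
  ⨆ (n : ℕ) (m : ℕ)
    (_ : 0 < n ∧ 0 < m ∧ ConfusesOnto (powHyp X n) (powHyp Y m)),
    (m : ℝ≥0∞) / (n : ℝ≥0∞)

/-- The fibre of `f` over `y`. -/
def fibF {Ω' : Type*} [Fintype Ω] (f : Ω → Ω') (y : Ω') : Finset Ω :=
  univ.filter fun ω => f ω = y

lemma mem_fibF {Ω' : Type*} [Fintype Ω] (f : Ω → Ω') (y : Ω') (ω : Ω) :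
    ω ∈ fibF f y ↔ f ω = y := by simp [fibF]

lemma mem_oiF {Ω' : Type*} [Fintype Ω] (f : Ω → Ω') (A : Finset Ω) :
    A ∈ oiF f ↔ ∀ a ∈ A, ∀ b ∈ A, f a = f b := by
  simp [oiF, Finset.card_le_one]

lemma fibF_mem {Ω' : Type*} [Fintype Ω] (f : Ω → Ω') (y : Ω') : fibF f y ∈ oiF f := by
  rw [mem_oiF]
  intro a ha b hb
  rw [mem_fibF] at ha hb
  rw [ha, hb]

lemma oiF_sub {Ω' : Type*} [Fintype Ω] (f : Ω → Ω') (A : Finset Ω) (hA : A ∈ oiF f)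
    (y0 : Ω') : ∃ y, A ⊆ fibF f y := by
  rcases A.eq_empty_or_nonempty with rfl | ⟨a, ha⟩
  · exact ⟨y0, by simp⟩
  · refine ⟨f a, fun b hb => ?_⟩
    rw [mem_fibF]
    exact (mem_oiF f A).1 hA b hb a ha

lemma pset_mono (p : Ω → ℝ) (h0 : ∀ ω, 0 ≤ p ω) {A B : Finset Ω} (h : A ⊆ B) :
    pset p A ≤ pset p B :=
  Finset.sum_le_sum_of_subset_of_nonneg h fun i _ _ => h0 i

lemma pset_nonneg (p : Ω → ℝ) (h0 : ∀ ω, 0 ≤ p ω) (A : Finset Ω) : 0 ≤ pset p A :=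
  Finset.sum_nonneg fun i _ => h0 i

lemma negLog2_anti {x y : ℝ} (h : x ≤ y) : negLog2 y ≤ negLog2 x := by
  unfold negLog2
  by_cases hx : x ≤ 0
  · simp [hx]
  · push Not at hx
    rw [if_neg (by linarith), if_neg (by linarith)]
    apply ENNReal.ofReal_le_ofReal
    apply Real.logb_le_logb_of_le (by norm_num)
    · exact inv_pos.2 (by linarith)
    · exact inv_anti₀ hx h

lemma hmin_part {Ω' : Type*} [Fintype Ω] [Fintype Ω'] (p : Ω → ℝ) (hp : IsPMF p)
    (f : Ω → Ω') (y0 : Ω') :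
    Hmin p (oiF f) = ⨅ y : Ω', negLog2 (pset p (fibF f y)) := by
  unfold Hmin
  apply le_antisymm
  · exact le_iInf fun y => iInf₂_le (fibF f y) (fibF_mem f y)
  · refine le_iInf₂ fun A hA => ?_
    obtain ⟨y, hy⟩ := oiF_sub f A hA y0
    exact (iInf_le _ y).trans (negLog2_anti (pset_mono p hp.1 hy))

/-- The support of the pushforward. -/
def pushSupp {Ω' : Type*} [Fintype Ω] [Fintype Ω'] (p : Ω → ℝ) (f : Ω → Ω') : Finset Ω' :=
  univ.filter fun y => 0 < pset p (fibF f y)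

lemma fib_pos {Ω' : Type*} [Fintype Ω] (p : Ω → ℝ) (h0 : ∀ ω, 0 ≤ p ω)
    (f : Ω → Ω') (ω : Ω) (h : 0 < p ω) : 0 < pset p (fibF f (f ω)) :=
  h.trans_le (Finset.single_le_sum (f := p) (fun i _ => h0 i) ((mem_fibF f _ ω).2 rfl))

lemma pushSupp_exists {Ω' : Type*} [Fintype Ω] [Fintype Ω'] (p : Ω → ℝ)
    (f : Ω → Ω') (y : Ω') (hy : y ∈ pushSupp p f) : ∃ ω, f ω = y ∧ 0 < p ω := by
  have h : 0 < pset p (fibF f y) := by simpa [pushSupp] using hy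
  obtain ⟨ω, hω, h'⟩ := Finset.exists_lt_of_sum_lt (s := fibF f y) (f := fun _ => (0 : ℝ)) (g := p)
    (by simpa [pset] using h)
  exact ⟨ω, (mem_fibF f y ω).1 hω, h'⟩

lemma pmf_exists [Fintype Ω] (p : Ω → ℝ) (hp : IsPMF p) : ∃ ω, 0 < p ω := by
  obtain ⟨ω, _, h⟩ := Finset.exists_lt_of_sum_lt (s := univ) (f := fun _ => (0 : ℝ)) (g := p)
    (by rw [hp.2]; simp)
  exact ⟨ω, h⟩

lemma pushSupp_card_pos {Ω' : Type*} [Fintype Ω] [Fintype Ω'] (p : Ω → ℝ) (hp : IsPMF p)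
    (f : Ω → Ω') : 0 < (pushSupp p f).card := by
  obtain ⟨ω, h⟩ := pmf_exists p hp
  exact Finset.card_pos.2 ⟨f ω, by simpa [pushSupp] using fib_pos p hp.1 f ω h⟩

lemma heps_lower {Ω' : Type*} [Fintype Ω] [Fintype Ω'] (p : Ω → ℝ) (hp : IsPMF p)
    (f : Ω → Ω') :
    ENNReal.ofReal (Real.logb 2 ((pushSupp p f).card : ℝ)) ≤ Heps p (oiF f) := by
  unfold Heps
  refine le_iInf₂ fun μ hμ => ?_
  obtain ⟨h0, -, hc⟩ := hμ
  apply ENNReal.ofReal_le_ofReal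
  apply Real.logb_le_logb_of_le (by norm_num)
  · exact_mod_cast pushSupp_card_pos p hp f
  have hex := fun y : pushSupp p f => pushSupp_exists p f y.1 y.2
  choose w hw1 hw2 using hex
  calc ((pushSupp p f).card : ℝ) = ∑ y : pushSupp p f, (1 : ℝ) := by simp
    _ ≤ ∑ y : pushSupp p f, ∑ A ∈ oiF f, if w y ∈ A then μ A else 0 :=
        Finset.sum_le_sum fun y _ => hc _ (hw2 y)
    _ = ∑ A ∈ oiF f, ∑ y : pushSupp p f, if w y ∈ A then μ A else 0 := Finset.sum_comm
    _ ≤ ∑ A ∈ oiF f, μ A := by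
        refine Finset.sum_le_sum fun A hA => ?_
        rw [← Finset.sum_filter, Finset.sum_const, nsmul_eq_mul]
        have hcard : (univ.filter fun y : pushSupp p f => w y ∈ A).card ≤ 1 := by
          rw [Finset.card_le_one]
          intro a ha b hb
          simp only [Finset.mem_filter, Finset.mem_univ, true_and] at ha hb
          have := (mem_oiF f A).1 hA _ ha _ hb
          rw [hw1, hw1] at this
          exact Subtype.ext this
        have hcard' : ((univ.filter fun y : pushSupp p f => w y ∈ A).card : ℝ) ≤ 1 := by
          exact_mod_cast hcard
        nlinarith [h0 A]

lemma heps_le_h0 [Fintype Ω] (p : Ω → ℝ) (X : Finset (Finset Ω)) : Heps p X ≤ H0ent p X := by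
  unfold H0ent
  refine le_iInf₂ fun S hS => ?_
  obtain ⟨hS1, hS2⟩ := hS
  unfold Heps
  refine (iInf₂_le (fun A => if A ∈ S then (1 : ℝ) else 0) ⟨?_, ?_, ?_⟩).trans ?_
  rotate_left 1
  · intro A
    dsimp only
    split_ifs <;> norm_num
  · intro A hA
    by_contra h
    exact hA (if_neg fun h' => h (hS1 h'))
  · intro ω hω
    obtain ⟨A, hA, hωA⟩ := hS2 ω hω
    refine le_trans ?_ (Finset.single_le_sum (a := A) ?_ (hS1 hA))
    · simp [hA, hωA]
    · intro B _
      dsimp only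
      split_ifs <;> norm_num
  · have : (∑ A ∈ X, if A ∈ S then (1 : ℝ) else 0) = S.card := by
      rw [← Finset.sum_filter, Finset.filter_mem_eq_inter, Finset.inter_eq_right.2 hS1]
      simp
    rw [this]

lemma h0_upper {Ω' : Type*} [Fintype Ω] [Fintype Ω'] (p : Ω → ℝ) (hp : IsPMF p)
    (f : Ω → Ω') :
    H0ent p (oiF f) ≤ ENNReal.ofReal (Real.logb 2 ((pushSupp p f).card : ℝ)) := by
  unfold H0ent
  refine (iInf₂_le ((pushSupp p f).image (fibF f)) ⟨?_, ?_⟩).trans ?_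
  rotate_left 1
  · intro A hA
    obtain ⟨y, -, rfl⟩ := Finset.mem_image.1 hA
    exact fibF_mem f y
  · intro ω hω
    refine ⟨fibF f (f ω), Finset.mem_image_of_mem _ ?_, (mem_fibF f _ _).2 rfl⟩
    simpa [pushSupp] using fib_pos p hp.1 f ω hω
  · apply ENNReal.ofReal_le_ofReal
    apply Real.logb_le_logb_of_le (by norm_num)
    · have := Finset.card_pos.1 (pushSupp_card_pos p hp f)
      exact_mod_cast Finset.card_pos.2 (this.image _)
    · exact_mod_cast Finset.card_image_le

lemma shannon_eq {Ω' : Type*} [Fintype Ω] [Fintype Ω'] (p : Ω → ℝ) (f : Ω → Ω') :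
    ∑ y : Ω', pset p (fibF f y) * Real.logb 2 (pset p (fibF f y))⁻¹ =
      ∑ z : Ω, p z * Real.logb 2 (pset p (fibF f (f z)))⁻¹ := by
  rw [← Finset.sum_fiberwise univ f]
  refine Finset.sum_congr rfl fun y _ => ?_
  conv_lhs => enter [1]; unfold pset
  rw [Finset.sum_mul]
  refine Finset.sum_congr rfl fun z hz => ?_
  rw [(mem_fibF f y z).1 hz]

lemma hent_upper {Ω' : Type*} [Fintype Ω] [Fintype Ω'] (p : Ω → ℝ) (f : Ω → Ω') :
    Hent p (oiF f) ≤
      ENNReal.ofReal (∑ z : Ω, p z * Real.logb 2 (pset p (fibF f (f z)))⁻¹) := by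
  unfold Hent
  refine (iInf₂_le (fun z A => if A = fibF f (f z) then (1 : ℝ) else 0) ⟨?_, ?_, ?_, ?_⟩).trans ?_
  rotate_left 1
  · intro z A
    dsimp only
    split_ifs <;> norm_num
  · intro z
    simp
  · intro z A h
    by_cases hA : A = fibF f (f z)
    · rw [hA]; exact fibF_mem f _
    · simp [hA] at h
  · intro z A _ h
    by_cases hA : A = fibF f (f z)
    · rw [hA]; exact (mem_fibF f _ _).2 rfl
    · simp [hA] at h
  · apply ENNReal.ofReal_le_ofReal
    apply le_of_eq
    unfold MI
    refine Finset.sum_congr rfl fun z _ => ?_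
    rw [Finset.sum_eq_single (fibF f (f z))]
    · have : (∑ z' : Ω, p z' * if fibF f (f z) = fibF f (f z') then (1 : ℝ) else 0)
          = pset p (fibF f (f z)) := by
        unfold pset
        conv_rhs => unfold fibF
        rw [Finset.sum_filter]
        refine Finset.sum_congr rfl fun z' _ => ?_
        have hiff : fibF f (f z) = fibF f (f z') ↔ f z' = f z := by
          constructor
          · intro h
            have h1 : z' ∈ fibF f (f z') := (mem_fibF f _ _).2 rfl
            rw [← h] at h1
            exact (mem_fibF f _ _).1 h1
          · intro h
            rw [h]
        simp [hiff]
      rw [this]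
      simp
    · intro A _ hA
      simp [hA]
    · simp

lemma hent_lower {Ω' : Type*} [Fintype Ω] [Fintype Ω'] (p : Ω → ℝ) (hp : IsPMF p)
    (f : Ω → Ω') (y0 : Ω') :
    ENNReal.ofReal (∑ z : Ω, p z * Real.logb 2 (pset p (fibF f (f z)))⁻¹) ≤
      Hent p (oiF f) := by
  unfold Hent
  refine le_iInf₂ fun k hk => ?_
  obtain ⟨k0, k1, kX, kz⟩ := hk
  apply ENNReal.ofReal_le_ofReal
  set r : Finset Ω → ℝ := fun A => ∑ z' : Ω, p z' * k z' A with hr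
  set q : Ω → ℝ := fun z => pset p (fibF f (f z)) with hq
  set c : Ω → Finset Ω → ℝ := fun z A => if A ∈ oiF f ∧ z ∈ A then p z / q z else 0 with hc
  have r0 : ∀ A, 0 ≤ r A := fun A => Finset.sum_nonneg fun z _ => mul_nonneg (hp.1 z) (k0 z A)
  have q0 : ∀ z, 0 ≤ q z := fun z => pset_nonneg p hp.1 _
  have c0 : ∀ z A, 0 ≤ c z A := by
    intro z A
    simp only [hc]
    split_ifs
    · exact div_nonneg (hp.1 z) (q0 z)
    · exact le_rfl
  have l2 : 0 < Real.log 2 := Real.log_pos (by norm_num)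
  have csum : ∀ A, ∑ z, c z A ≤ 1 := by
    intro A
    by_cases hA : A ∈ oiF f
    · obtain ⟨y, hy⟩ := oiF_sub f A hA y0
      calc ∑ z, c z A = ∑ z ∈ A, p z / q z := by
            simp [hc, hA, Finset.sum_ite_mem]
        _ ≤ ∑ z ∈ fibF f y, p z / q z :=
            Finset.sum_le_sum_of_subset_of_nonneg hy fun z _ _ => div_nonneg (hp.1 z) (q0 z)
        _ = ∑ z ∈ fibF f y, p z / pset p (fibF f y) := by
            refine Finset.sum_congr rfl fun z hz => ?_
            simp only [hq]
            rw [(mem_fibF f y z).1 hz]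
        _ = pset p (fibF f y) / pset p (fibF f y) := by
            rw [← Finset.sum_div]; rfl
        _ ≤ 1 := div_self_le_one _
    · simp [hc, hA]
  have term : ∀ z A, (p z * k z A - c z A * r A) / Real.log 2 ≤
      p z * k z A * Real.logb 2 (k z A / r A) - p z * k z A * Real.logb 2 (q z)⁻¹ := by
    intro z A
    by_cases h : p z * k z A = 0
    · rw [h]
      have := mul_nonneg (c0 z A) (r0 A)
      simp only [zero_mul, sub_self, zero_sub]
      exact div_nonpos_of_nonpos_of_nonneg (by linarith) l2.le
    · have hpz : 0 < p z := lt_of_le_of_ne (hp.1 z) fun h' => h (by rw [← h', zero_mul])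
      have hkz : 0 < k z A := lt_of_le_of_ne (k0 z A) fun h' => h (by rw [← h', mul_zero])
      have hAX := kX z A hkz
      have hzA := kz z A hpz hkz
      have hqz : 0 < q z := fib_pos p hp.1 f z hpz
      have hrA : 0 < r A := (mul_pos hpz hkz).trans_le
        (Finset.single_le_sum (f := fun z' => p z' * k z' A)
          (fun i _ => mul_nonneg (hp.1 i) (k0 i A)) (Finset.mem_univ z))
      have hcz : c z A = p z / q z := if_pos ⟨hAX, hzA⟩
      have hlog := Real.one_sub_inv_le_log_of_pos (x := k z A / r A * q z) (by positivity)
      rw [Real.log_mul (by positivity) (by positivity)] at hlog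
      have e : p z * k z A * Real.logb 2 (k z A / r A) - p z * k z A * Real.logb 2 (q z)⁻¹
          = (p z * k z A * (Real.log (k z A / r A) + Real.log (q z))) / Real.log 2 := by
        unfold Real.logb
        rw [Real.log_inv]
        ring
      rw [e, hcz]
      apply div_le_div_of_nonneg_right _ l2.le
      have h3 := mul_le_mul_of_nonneg_left hlog (mul_pos hpz hkz).le
      refine le_trans (le_of_eq ?_) h3
      field_simp
  have hsum := Finset.sum_le_sum fun z (_ : z ∈ univ) =>
    Finset.sum_le_sum fun A (_ : A ∈ (univ : Finset (Finset Ω))) => term z A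
  have pk1 : ∑ z, ∑ A, p z * k z A = 1 := by
    simp_rw [← Finset.mul_sum, k1, mul_one]
    exact hp.2
  have rsum : ∑ A, r A = 1 := by
    rw [← pk1, Finset.sum_comm]
  have crsum : ∑ z, ∑ A, c z A * r A ≤ 1 := by
    rw [Finset.sum_comm, ← rsum]
    refine Finset.sum_le_sum fun A _ => ?_
    rw [← Finset.sum_mul]
    exact mul_le_of_le_one_left (r0 A) (csum A)
  simp_rw [← Finset.sum_div, Finset.sum_sub_distrib] at hsum
  rw [pk1] at hsum
  have e2 : ∑ z, ∑ A, p z * k z A * Real.logb 2 (q z)⁻¹ = ∑ z, p z * Real.logb 2 (q z)⁻¹ := by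
    refine Finset.sum_congr rfl fun z _ => ?_
    rw [← Finset.sum_mul, ← Finset.mul_sum, k1, mul_one]
  rw [e2] at hsum
  have : 0 ≤ (1 - ∑ z, ∑ A, c z A * r A) / Real.log 2 := div_nonneg (by linarith) l2.le
  have h4 : MI p k = ∑ z, ∑ A, p z * k z A * Real.logb 2 (k z A / r A) := rfl
  rw [h4]
  linarith

/-- For the ordinary information `oi(f)` induced by `f : Ω → Ω'`,
the entropy is the Shannon entropy of the pushforward distribution, the min-entropy is
`−log₂ max_y p(f⁻¹(y))`, and `H₀ = Hε = log₂ |{y : p(f⁻¹(y)) > 0}|`. -/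
theorem stmt6 {Ω' : Type*} [Fintype Ω] [Fintype Ω'] (p : Ω → ℝ) (hp : IsPMF p)
    (f : Ω → Ω') :
    Hent p (oiF f) =
      ENNReal.ofReal (∑ y : Ω', pset p (univ.filter fun ω => f ω = y) *
        Real.logb 2 (pset p (univ.filter fun ω => f ω = y))⁻¹) ∧
    Hmin p (oiF f) = (⨅ y : Ω', negLog2 (pset p (univ.filter fun ω => f ω = y))) ∧
    H0ent p (oiF f) =
      ENNReal.ofReal (Real.logb 2
        (((univ.filter fun y : Ω' => 0 < pset p (univ.filter fun ω => f ω = y)).card : ℝ))) ∧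
    Heps p (oiF f) =
      ENNReal.ofReal (Real.logb 2
        (((univ.filter fun y : Ω' => 0 < pset p (univ.filter fun ω => f ω = y)).card : ℝ))) := by
  obtain ⟨ω0, -⟩ := pmf_exists p hp
  have h1 := heps_lower p hp f
  have h2 := heps_le_h0 p (oiF f)
  have h3 := h0_upper p hp f
  refine ⟨?_, hmin_part p hp f (f ω0), le_antisymm h3 (h1.trans h2), le_antisymm (h2.trans h3) h1⟩
  refine (le_antisymm (hent_upper p f) (hent_lower p hp f (f ω0))).trans ?_
  rw [← shannon_eq]
  rfl

end
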